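/- The mobile distance induces the same convergent sequences as the norm topology: for a sequence (v^n) in L² and v ∈ L², one has m_φ(v^n, v) → 0 as n → ∞ if and only if ‖v^n − v‖₂ → 0 as n → ∞. -/

import Mathlib

open MeasureTheory Filter

noncomputable section

/-- Translation `(τ_q v)(x) = v(x - q)` acting on `L²(ℝ^d; ℝ)`. -/
def tau {d : ℕ} (q : EuclideanSpace ℝ (Fin d))
    (v : Lp ℝ 2 (volume : Measure (EuclideanSpace ℝ (Fin d)))) :
    Lp ℝ 2 (volume : Measure (EuclideanSpace ℝ (Fin d))) :=
  Lp.compMeasurePreserving (fun x => x - q) (measurePreserving_sub_right volume q) v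

/-- The squared mobile distance
`m_φ(v⁰, v¹)² = inf { ‖v^{1−j} − τ_q v^j‖₂² + |q|² φ(‖v^j‖₂)² : q ∈ ℝ^d, j ∈ {0,1} }`. -/
def mobSq {d : ℕ} (φ : ℝ → ℝ)
    (v0 v1 : Lp ℝ 2 (volume : Measure (EuclideanSpace ℝ (Fin d)))) : ℝ :=
  sInf {r : ℝ | ∃ q : EuclideanSpace ℝ (Fin d),
      r = ‖v1 - tau q v0‖ ^ 2 + ‖q‖ ^ 2 * φ ‖v0‖ ^ 2 ∨
      r = ‖v0 - tau q v1‖ ^ 2 + ‖q‖ ^ 2 * φ ‖v1‖ ^ 2}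

/-- The mobile distance `m_φ`. -/
def mob {d : ℕ} (φ : ℝ → ℝ)
    (v0 v1 : Lp ℝ 2 (volume : Measure (EuclideanSpace ℝ (Fin d)))) : ℝ :=
  Real.sqrt (mobSq φ v0 v1)

end

lemma tau_zero {d : ℕ} (v : Lp ℝ 2 (volume : Measure (EuclideanSpace ℝ (Fin d)))) :
    tau 0 v = v := by
  apply Lp.ext
  filter_upwards [Lp.coeFn_compMeasurePreserving v
    (measurePreserving_sub_right volume (0 : EuclideanSpace ℝ (Fin d)))] with x hx
  simpa [tau] using hx

lemma isometry_tau {d : ℕ} (q : EuclideanSpace ℝ (Fin d)) : Isometry (tau q) :=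
  Lp.isometry_compMeasurePreserving (measurePreserving_sub_right volume q)

lemma tau_apply_zero {d : ℕ} (q : EuclideanSpace ℝ (Fin d)) : tau q 0 = 0 :=
  map_zero (Lp.compMeasurePreserving _ (measurePreserving_sub_right volume q))

lemma norm_tau {d : ℕ} (q : EuclideanSpace ℝ (Fin d))
    (v : Lp ℝ 2 (volume : Measure (EuclideanSpace ℝ (Fin d)))) : ‖tau q v‖ = ‖v‖ :=
  Lp.norm_compMeasurePreserving v (measurePreserving_sub_right volume q)

/-- Translations are strongly continuous on `L²`. -/
lemma continuous_tau {d : ℕ} (v : Lp ℝ 2 (volume : Measure (EuclideanSpace ℝ (Fin d)))) :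
    Continuous fun q => tau q v := by
  let f : EuclideanSpace ℝ (Fin d) →
      C(EuclideanSpace ℝ (Fin d), EuclideanSpace ℝ (Fin d)) :=
    fun q => ⟨fun x => x - q, by fun_prop⟩
  have hf : Continuous f := ContinuousMap.continuous_of_continuous_uncurry _ (by
    change Continuous fun p : EuclideanSpace ℝ (Fin d) × EuclideanSpace ℝ (Fin d) => p.2 - p.1
    fun_prop)
  exact Continuous.compMeasurePreservingLp (f := fun _ => v) (g := f) continuous_const hf
    (fun q => measurePreserving_sub_right volume q) ENNReal.ofNat_ne_top

lemma mob_le_norm_sub {d : ℕ} (φ : ℝ → ℝ)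
    (v w : Lp ℝ 2 (volume : Measure (EuclideanSpace ℝ (Fin d)))) :
    mob φ v w ≤ ‖v - w‖ := by
  refine Real.sqrt_le_iff.mpr ⟨norm_nonneg _, csInf_le ⟨0, ?_⟩ ⟨0, Or.inr ?_⟩⟩
  · rintro r ⟨q, rfl | rfl⟩ <;> positivity
  · simp [tau_zero]

/-- Smallness of the mobile distance yields a translation that is close to the identity
relative to `w` and controls the norm distance. -/
lemma exists_translation_of_mob_lt {d : ℕ} {φ : ℝ → ℝ} (hφ : ∀ a : ℝ, 0 ≤ a → a ≤ φ a)
    {v w : Lp ℝ 2 (volume : Measure (EuclideanSpace ℝ (Fin d)))} {s : ℝ}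
    (h : mob φ v w < s) :
    ∃ q : EuclideanSpace ℝ (Fin d),
      ‖v - w‖ < s + ‖tau q w - w‖ ∧ ‖q‖ * (‖w‖ - s) < s := by
  have hs : 0 < s := (Real.sqrt_nonneg _).trans_lt h
  have hsq : mobSq φ v w < s ^ 2 := (Real.sqrt_lt' hs).mp h
  have key : ∀ (q : EuclideanSpace ℝ (Fin d))
      (x : Lp ℝ 2 (volume : Measure (EuclideanSpace ℝ (Fin d)))) (a : ℝ), 0 ≤ a →
      ‖x‖ ^ 2 + ‖q‖ ^ 2 * φ a ^ 2 < s ^ 2 → ‖x‖ < s ∧ ‖q‖ * a < s := by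
    intro q x a ha hlt
    have hle : (‖q‖ * a) ^ 2 ≤ ‖q‖ ^ 2 * φ a ^ 2 := by
      rw [mul_pow]
      have := hφ a ha
      gcongr
    exact ⟨lt_of_pow_lt_pow_left₀ 2 hs.le (by nlinarith [sq_nonneg (‖q‖ * φ a)]),
      lt_of_pow_lt_pow_left₀ 2 hs.le (by nlinarith [sq_nonneg ‖x‖])⟩
  obtain ⟨r, ⟨q, hq⟩, hr⟩ := exists_lt_of_csInf_lt (by exact ⟨_, 0, Or.inl rfl⟩) hsq
  refine ⟨q, ?_⟩
  rcases hq with rfl | rfl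
  · obtain ⟨h1, h2⟩ := key q _ _ (norm_nonneg _) hr
    have hw : ‖w‖ ≤ ‖w - tau q v‖ + ‖v‖ := by
      simpa [norm_tau] using norm_add_le (w - tau q v) (tau q v)
    refine ⟨?_, lt_of_le_of_lt (by gcongr; linarith) h2⟩
    rw [← dist_eq_norm, ← (isometry_tau q).dist_eq]
    rw [← dist_eq_norm, dist_comm] at h1
    have := dist_triangle_right (tau q v) (tau q w) w
    rw [← dist_eq_norm]
    linarith
  · obtain ⟨h1, h2⟩ := key q _ _ (norm_nonneg _) hr
    refine ⟨?_, lt_of_le_of_lt (by gcongr; linarith) h2⟩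
    have := norm_sub_le_norm_sub_add_norm_sub v (tau q w) w
    linarith

/-- Functions at small mobile distance from `w` are close to `w` in norm. -/
lemma exists_pos_forall_mob_lt {d : ℕ} {φ : ℝ → ℝ} (hφ : ∀ a : ℝ, 0 ≤ a → a ≤ φ a)
    (w : Lp ℝ 2 (volume : Measure (EuclideanSpace ℝ (Fin d)))) {ε : ℝ} (hε : 0 < ε) :
    ∃ s > 0, ∀ v, mob φ v w < s → ‖v - w‖ < ε := by
  rcases eq_or_ne w 0 with rfl | hw
  · refine ⟨ε, hε, fun v hv => ?_⟩
    obtain ⟨q, hq, -⟩ := exists_translation_of_mob_lt hφ hv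
    simpa [tau_apply_zero] using hq
  · have hw' : 0 < ‖w‖ := norm_pos_iff.mpr hw
    obtain ⟨η, hη, hcont⟩ := Metric.continuousAt_iff.mp
      ((continuous_tau w).continuousAt (x := 0)) (ε / 2) (half_pos hε)
    refine ⟨min (ε / 2) (min (‖w‖ / 2) (η * (‖w‖ / 2))), by positivity, fun v hv => ?_⟩
    obtain ⟨q, h1, h2⟩ := exists_translation_of_mob_lt hφ hv
    set s := min (ε / 2) (min (‖w‖ / 2) (η * (‖w‖ / 2)))
    have hs1 : s ≤ ε / 2 := min_le_left _ _
    have hs2 : s ≤ ‖w‖ / 2 := (min_le_right _ _).trans (min_le_left _ _)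
    have hs3 : s ≤ η * (‖w‖ / 2) := (min_le_right _ _).trans (min_le_right _ _)
    have hq : ‖q‖ < η := by
      have : ‖q‖ * (‖w‖ / 2) ≤ ‖q‖ * (‖w‖ - s) := by gcongr; linarith
      exact lt_of_mul_lt_mul_right (by linarith) (half_pos hw').le
    have hqw : dist (tau q w) (tau 0 w) < ε / 2 := hcont (by simpa using hq)
    rw [tau_zero, dist_eq_norm] at hqw
    linarith

/-- **The mobile distance induces the same convergent sequences as the norm topology**:
for a sequence `(v^n)` in `L²` and `v ∈ L²`, `m_φ(v^n, v) → 0` iff `‖v^n − v‖₂ → 0`. -/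
theorem mob_convergence_iff_norm_convergence {d : ℕ} (hd : 0 < d) (φ : ℝ → ℝ)
    (hφc : ContinuousOn φ (Set.Ici 0)) (hφm : MonotoneOn φ (Set.Ici 0))
    (hφ1 : ∀ a : ℝ, 0 ≤ a → a ≤ φ a)
    (hφ4 : ∀ a b : ℝ, 0 ≤ a → 0 ≤ b → b ≤ 2 * a → φ b ≤ 4 * φ a)
    (v : ℕ → Lp ℝ 2 (volume : Measure (EuclideanSpace ℝ (Fin d))))
    (w : Lp ℝ 2 (volume : Measure (EuclideanSpace ℝ (Fin d)))) :
    Tendsto (fun n => mob φ (v n) w) atTop (nhds 0) ↔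
      Tendsto (fun n => ‖v n - w‖) atTop (nhds 0) := by
  constructor
  · intro h
    rw [Metric.tendsto_atTop]
    intro ε hε
    obtain ⟨s, hs, hsw⟩ := exists_pos_forall_mob_lt hφ1 w hε
    obtain ⟨N, hN⟩ := eventually_atTop.mp (h.eventually (gt_mem_nhds hs))
    exact ⟨N, fun n hn => by simpa using hsw _ (hN n hn)⟩
  · exact squeeze_zero (fun _ => Real.sqrt_nonneg _) fun n => mob_le_norm_sub φ (v n) w
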